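/- Suppose k is an algebraically closed field of characteristic 0. For every subset Z ⊆ Φ there exists a finite set B of invariant monomials, each with support contained in Φ \ Z, such that for all F, F' : Φ → k whose common zero set is Z (i.e. {φ : F(φ) = 0} = {φ : F'(φ) = 0} = Z), one has F ∼ F' if and only if F(m) = F'(m) for all m ∈ B. -/

import Mathlib

open Finsupp

/-- The unique additive homomorphism `(Φ →₀ ℤ) →+ (Γ →₀ ℤ)` sending `single φ 1` to `t φ`. -/
noncomputable def tA {Φ Γ : Type*} (t : Φ → (Γ →₀ ℤ)) : (Φ →₀ ℤ) →+ (Γ →₀ ℤ) :=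
  Finsupp.liftAddHom fun φ => zmultiplesHom _ (t φ)

theorem tA_single {Φ Γ : Type*} (t : Φ → (Γ →₀ ℤ)) (φ : Φ) :
    tA t (Finsupp.single φ 1) = t φ := by
  simp [tA]

/-- The action of a gauge transformation `g : Γ → kˣ` on `F : Φ → k`. -/
noncomputable def gaugeAct {k : Type*} [Field k] {Φ Γ : Type*} [Fintype Γ]
    (t : Φ → (Γ →₀ ℤ)) (g : Γ → kˣ) (F : Φ → k) : Φ → k :=
  fun φ => ((∏ γ : Γ, g γ ^ (t φ) γ : kˣ) : k) * F φ

/-- Gauge equivalence of `F, F' : Φ → k`. -/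
def gaugeEquiv {k : Type*} [Field k] {Φ Γ : Type*} [Fintype Γ]
    (t : Φ → (Γ →₀ ℤ)) (F F' : Φ → k) : Prop :=
  ∃ g : Γ → kˣ, F' = gaugeAct t g F

/-- Evaluation of a monomial `m : Φ →₀ ℤ` at a point `F : Φ → k`. -/
noncomputable def evalMon {k : Type*} [Field k] {Φ : Type*} [Fintype Φ] (F : Φ → k) (m : Φ →₀ ℤ) : k :=
  ∏ φ : Φ, F φ ^ m φ

/-- The action of a permutation of `Φ` on `F : Φ → k`. -/
def permAct {k Φ : Type*} (ρ : Equiv.Perm Φ) (F : Φ → k) : Φ → k :=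
  fun φ => F (ρ.symm φ)


/-- The group of units of an algebraically closed field is divisible. -/
noncomputable instance (k : Type*) [Field k] [IsAlgClosed k] : DivisibleBy (Additive kˣ) ℕ :=
  divisibleByOfSMulRightSurj _ _ fun {n} hn a => by
    obtain ⟨z, hz⟩ := IsAlgClosed.exists_pow_nat_eq (a.toMul : k) (Nat.pos_of_ne_zero hn)
    have hz0 : z ≠ 0 := by
      rintro rfl
      rw [zero_pow hn] at hz
      exact a.toMul.ne_zero hz.symm
    exact ⟨Additive.ofMul (Units.mk0 z hz0), Additive.toMul.injective (Units.ext hz)⟩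

/-- A homomorphism into a divisible group that vanishes on the kernel of `T` factors
through `T`. -/
theorem exists_comp_eq_of_ker_le_of_divisibleBy {N M A : Type*} [AddCommGroup N]
    [AddCommGroup M] [AddCommGroup A] [DivisibleBy A ℤ] (T : N →ₗ[ℤ] M) (χ : N →ₗ[ℤ] A)
    (h : LinearMap.ker T ≤ LinearMap.ker χ) : ∃ e : M →ₗ[ℤ] A, e ∘ₗ T = χ := by
  obtain ⟨e, he⟩ := (Module.Baer.of_divisible A).extension_property
    ((LinearMap.ker T).liftQ T le_rfl)
    (LinearMap.ker_eq_bot.mp (Submodule.ker_liftQ_eq_bot' _ _ rfl))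
    ((LinearMap.ker T).liftQ χ h)
  refine ⟨e, LinearMap.ext fun x => ?_⟩
  simpa using LinearMap.congr_fun he (Submodule.Quotient.mk x)

/-- The homomorphism `m ↦ ∏ u i ^ m i` from exponent vectors to an abelian group. -/
noncomputable def monomialHom {ι G : Type*} [CommGroup G] (u : ι → G) :
    (ι →₀ ℤ) →ₗ[ℤ] Additive G :=
  Finsupp.linearCombination ℤ fun i => Additive.ofMul (u i)

theorem toMul_monomialHom {ι G : Type*} [Fintype ι] [CommGroup G] (u : ι → G) (m : ι →₀ ℤ) :
    (monomialHom u m).toMul = ∏ i, u i ^ m i := by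
  rw [monomialHom, Finsupp.linearCombination_apply, Finsupp.sum_fintype _ _ (by simp)]
  simp

theorem monomialHom_single {ι G : Type*} [CommGroup G] (u : ι → G) (i : ι) :
    monomialHom u (Finsupp.single i 1) = Additive.ofMul (u i) := by
  simp [monomialHom]

theorem eq_monomialHom {ι G : Type*} [CommGroup G] (e : (ι →₀ ℤ) →ₗ[ℤ] Additive G) :
    e = monomialHom fun i => (e (Finsupp.single i 1)).toMul := by
  ext i
  simp [monomialHom]

theorem monomialHom_tA {Φ Γ G : Type*} [CommGroup G] (t : Φ → (Γ →₀ ℤ)) (g : Γ → G)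
    (m : Φ →₀ ℤ) :
    monomialHom g (tA t m) = monomialHom (fun φ => (monomialHom g (t φ)).toMul) m := by
  have h := eq_monomialHom (monomialHom g ∘ₗ (tA t).toIntLinearMap)
  simpa [tA_single] using LinearMap.congr_fun h m

theorem gaugeAct_apply {k : Type*} [Field k] {Φ Γ : Type*} [Fintype Γ]
    (t : Φ → (Γ →₀ ℤ)) (g : Γ → kˣ) (F : Φ → k) (φ : Φ) :
    gaugeAct t g F φ = ((monomialHom g (t φ)).toMul : kˣ) * F φ := by
  rw [toMul_monomialHom, gaugeAct]

theorem evalMon_units_mul {k : Type*} [Field k] {Φ : Type*} [Fintype Φ] (u : Φ → kˣ)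
    (F : Φ → k) (m : Φ →₀ ℤ) :
    evalMon (fun φ => u φ * F φ) m = ((monomialHom u m).toMul : kˣ) * evalMon F m := by
  simp [evalMon, toMul_monomialHom, mul_zpow, Finset.prod_mul_distrib]

theorem evalMon_ne_zero {k : Type*} [Field k] {Φ : Type*} [Fintype Φ] {F : Φ → k}
    {m : Φ →₀ ℤ} (h : ∀ φ ∈ m.support, F φ ≠ 0) : evalMon F m ≠ 0 := by
  refine Finset.prod_ne_zero_iff.mpr fun φ _ => ?_
  by_cases hφ : m φ = 0
  · simp [hφ]
  · exact zpow_ne_zero _ (h φ (Finsupp.mem_support_iff.mpr hφ))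

/-- Invariant monomials have the same value at gauge-related points. -/
theorem evalMon_gaugeAct {k : Type*} [Field k] {Φ Γ : Type*} [Fintype Φ] [Fintype Γ]
    (t : Φ → (Γ →₀ ℤ)) (g : Γ → kˣ) (F : Φ → k) {m : Φ →₀ ℤ} (hm : tA t m = 0) :
    evalMon (gaugeAct t g F) m = evalMon F m := by
  rw [funext (gaugeAct_apply t g F), evalMon_units_mul, ← monomialHom_tA, hm]
  simp

/-- For every zero set `Z` there is a finite set `B` of invariant monomials supported away from
`Z` whose evaluations classify gauge classes with zero set `Z`. -/
theorem exists_finite_classifying_set {k : Type*} [Field k] [IsAlgClosed k] [CharZero k]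
    {Φ Γ : Type*} [Fintype Φ] [Fintype Γ] (t : Φ → (Γ →₀ ℤ)) (Z : Set Φ) :
    ∃ B : Finset (Φ →₀ ℤ),
      (∀ m ∈ B, tA t m = 0 ∧ ∀ φ ∈ m.support, φ ∉ Z) ∧
      ∀ F F' : Φ → k, {φ : Φ | F φ = 0} = Z → {φ : Φ | F' φ = 0} = Z →
        (gaugeEquiv t F F' ↔ ∀ m ∈ B, evalMon F m = evalMon F' m) := by
  let N : Submodule ℤ (Φ →₀ ℤ) := Finsupp.supported ℤ ℤ Zᶜ
  let T : (Φ →₀ ℤ) →ₗ[ℤ] (Γ →₀ ℤ) := (tA t).toIntLinearMap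
  obtain ⟨B, hB⟩ := IsNoetherian.noetherian (LinearMap.ker T ⊓ N)
  have hBmem : ∀ m ∈ B, tA t m = 0 ∧ ∀ φ ∈ m.support, φ ∉ Z := fun m hm => by
    have hm' : m ∈ LinearMap.ker T ⊓ N := hB ▸ Submodule.subset_span hm
    exact ⟨hm'.1, fun φ hφ => hm'.2 hφ⟩
  refine ⟨B, hBmem, fun F F' hF hF' => ⟨?_, fun h => ?_⟩⟩
  · rintro ⟨g, rfl⟩ m hm
    exact (evalMon_gaugeAct t g F (hBmem m hm).1).symm
  have hFZ : ∀ φ, F φ = 0 ↔ φ ∈ Z := fun φ => by rw [← hF]; rfl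
  have hFZ' : ∀ φ, F' φ = 0 ↔ φ ∈ Z := fun φ => by rw [← hF']; rfl
  have hu : ∀ φ, ∃ u : kˣ, F' φ = u * F φ := fun φ => by
    by_cases hφ : φ ∈ Z
    · exact ⟨1, by simp [(hFZ φ).2 hφ, (hFZ' φ).2 hφ]⟩
    · have h0 : F φ ≠ 0 := mt (hFZ φ).1 hφ
      have h0' : F' φ ≠ 0 := mt (hFZ' φ).1 hφ
      exact ⟨Units.mk0 (F' φ / F φ) (div_ne_zero h0' h0), (div_mul_cancel₀ _ h0).symm⟩
  choose u hu using hu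
  have hχ : LinearMap.ker T ⊓ N ≤ LinearMap.ker (monomialHom u) := by
    rw [← hB, Submodule.span_le]
    intro m hm
    have hne : evalMon F m ≠ 0 :=
      evalMon_ne_zero fun φ hφ => mt (hFZ φ).1 ((hBmem m hm).2 φ hφ)
    have hval := h m hm
    rw [funext hu, evalMon_units_mul, eq_comm, mul_eq_right₀ hne, Units.val_eq_one] at hval
    exact hval
  let _ : DivisibleBy (Additive kˣ) ℤ := AddGroup.divisibleByIntOfDivisibleByNat _
  obtain ⟨e, he⟩ := exists_comp_eq_of_ker_le_of_divisibleBy (T ∘ₗ N.subtype)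
    (monomialHom u ∘ₗ N.subtype) fun x hx => hχ ⟨hx, x.2⟩
  refine ⟨fun γ => (e (Finsupp.single γ 1)).toMul, funext fun φ => ?_⟩
  rw [gaugeAct_apply, ← eq_monomialHom e, hu]
  by_cases hφ : φ ∈ Z
  · simp [(hFZ φ).2 hφ]
  · have hmem : Finsupp.single φ (1 : ℤ) ∈ N := Finsupp.single_mem_supported ℤ 1 hφ
    have heφ : e (tA t (Finsupp.single φ 1)) = monomialHom u (Finsupp.single φ 1) :=
      LinearMap.congr_fun he ⟨_, hmem⟩
    rw [tA_single, monomialHom_single] at heφ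
    rw [heφ, toMul_ofMul]
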